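/- Let c>0 and z(t,ξ)=(t·B_g(f(ξ))+Δ(f(ξ)))/π. For every sufficiently small ε>0 there exists T=T(ε) such that for all t>T and all x satisfying 4c²t − ((1−ε)/(2c))·log t ≤ x < 4c²t, one has −1/2 ≤ z(t, x/(12t)) ≤ 1/2. -/

import Mathlib

/-- `μ²(d) = (∫₀^d y²·√((d²−y²)/(c²−y²)) dy)/(∫₀^d √((d²−y²)/(c²−y²)) dy)`. -/
noncomputable def mu2 (c d : ℝ) : ℝ :=
  (∫ y in (0:ℝ)..d, y^2 * Real.sqrt ((d^2 - y^2) / (c^2 - y^2))) /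
    (∫ y in (0:ℝ)..d, Real.sqrt ((d^2 - y^2) / (c^2 - y^2)))

/-- `B_g(d) = 24·∫_d^c (y²−μ²(d))·√(y²−d²)/√(c²−y²) dy`. -/
noncomputable def Bg (c d : ℝ) : ℝ :=
  24 * ∫ y in d..c, (y^2 - mu2 c d) * Real.sqrt (y^2 - d^2) / Real.sqrt (c^2 - y^2)

/-- `I₁(d) = ∫₀^d dy/√((c²−y²)(d²−y²))`. -/
noncomputable def I1 (c d : ℝ) : ℝ :=
  ∫ y in (0:ℝ)..d, 1 / Real.sqrt ((c^2 - y^2) * (d^2 - y^2))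

/-- `I₂(d) = ∫_d^c log(c/(2√(c²−y²)))·dy/√((c²−y²)(y²−d²))`. -/
noncomputable def I2 (c d : ℝ) : ℝ :=
  ∫ y in d..c, Real.log (c / (2 * Real.sqrt (c^2 - y^2))) /
    Real.sqrt ((c^2 - y^2) * (y^2 - d^2))

/-- `Δ(d) = −I₂(d)/I₁(d)`. -/
noncomputable def Delta (c d : ℝ) : ℝ := -(I2 c d) / I1 c d

/-- The phase variable `z(t,ξ) = (t·B_g(f(ξ)) + Δ(f(ξ)))/π`. -/
noncomputable def zvar (c : ℝ) (f : ℝ → ℝ) (t ξ : ℝ) : ℝ :=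
  (t * Bg c (f ξ) + Delta c (f ξ)) / Real.pi

open Set in
lemma cov_aux (φ φ' g h : ℝ → ℝ) (a b : ℝ) (hab : a < b)
    (hcont : ContinuousOn φ (Icc a b))
    (hd : ∀ x ∈ Ioo a b, HasDerivAt φ (φ' x) x)
    (hpos : ∀ x ∈ Ioo a b, 0 < φ' x)
    (hgh : ∀ x ∈ Ioo a b, φ' x * g (φ x) = h x) :
    ∫ y in (φ a)..(φ b), g y = ∫ x in a..b, h x := by
  have hmono : StrictMonoOn φ (Icc a b) := by
    apply strictMonoOn_of_deriv_pos (convex_Icc a b) hcont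
    intro x hx
    rw [interior_Icc] at hx
    rw [(hd x hx).deriv]
    exact hpos x hx
  have hlt : φ a < φ b := hmono (left_mem_Icc.2 hab.le) (right_mem_Icc.2 hab.le) hab
  have himg : φ '' Ioo a b = Ioo (φ a) (φ b) := by
    apply Subset.antisymm
    · rintro _ ⟨x, hx, rfl⟩
      exact ⟨hmono (left_mem_Icc.2 hab.le) (Ioo_subset_Icc_self hx) hx.1,
        hmono (Ioo_subset_Icc_self hx) (right_mem_Icc.2 hab.le) hx.2⟩
    · exact intermediate_value_Ioo hab.le hcont
  rw [intervalIntegral.integral_of_le hlt.le, intervalIntegral.integral_of_le hab.le,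
    MeasureTheory.integral_Ioc_eq_integral_Ioo, MeasureTheory.integral_Ioc_eq_integral_Ioo,
    ← himg, MeasureTheory.integral_image_eq_integral_abs_deriv_smul measurableSet_Ioo
      (fun x hx => (hd x hx).hasDerivWithinAt)
      (hmono.injOn.mono Ioo_subset_Icc_self)]
  apply MeasureTheory.setIntegral_congr_fun measurableSet_Ioo
  intro x hx
  simp only [smul_eq_mul]
  rw [abs_of_pos (hpos x hx), hgh x hx]

/-- The substitution `y = √(d² + (c²-d²) sin² θ)`. -/
noncomputable def Ysub (c d θ : ℝ) : ℝ := Real.sqrt (d^2 + (c^2 - d^2) * Real.sin θ ^ 2)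

section
variable {c d : ℝ}

lemma q_pos (hd : 0 < d) (hdc : d < c) : 0 < c^2 - d^2 := by nlinarith

lemma Ysub_sq (hd : 0 < d) (hdc : d < c) (θ : ℝ) :
    Ysub c d θ ^ 2 = d^2 + (c^2 - d^2) * Real.sin θ ^ 2 := by
  unfold Ysub
  rw [Real.sq_sqrt]
  have := q_pos hd hdc
  positivity

lemma le_Ysub (hd : 0 < d) (hdc : d < c) (θ : ℝ) : d ≤ Ysub c d θ := by
  apply Real.le_sqrt_of_sq_le
  have := q_pos hd hdc
  nlinarith [sq_nonneg (Real.sin θ), mul_nonneg this.le (sq_nonneg (Real.sin θ))]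

lemma Ysub_le (hd : 0 < d) (hdc : d < c) (θ : ℝ) : Ysub c d θ ≤ c := by
  unfold Ysub
  rw [Real.sqrt_le_left (by linarith)]
  have := q_pos hd hdc
  nlinarith [mul_nonneg this.le (sq_nonneg (Real.cos θ)), Real.sin_sq_add_cos_sq θ]

lemma Ysub_cont (c d : ℝ) : Continuous (Ysub c d) := by
  unfold Ysub; fun_prop

lemma cov_Y (hd : 0 < d) (hdc : d < c) (g h : ℝ → ℝ)
    (hgh : ∀ x ∈ Set.Ioo 0 (Real.pi/2),
      ((c^2 - d^2) * Real.sin x * Real.cos x / Ysub c d x) * g (Ysub c d x) = h x) :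
    ∫ y in d..c, g y = ∫ x in (0:ℝ)..(Real.pi/2), h x := by
  have h0 : Ysub c d 0 = d := by simp [Ysub, Real.sqrt_sq hd.le]
  have h1 : Ysub c d (Real.pi/2) = c := by simp [Ysub, Real.sqrt_sq (hd.trans hdc).le]
  have hq := q_pos hd hdc
  have key := cov_aux (Ysub c d)
    (fun x => (c^2 - d^2) * Real.sin x * Real.cos x / Ysub c d x) g h 0 (Real.pi/2)
    (by positivity) (Ysub_cont c d).continuousOn ?_ ?_ hgh
  · rwa [h0, h1] at key
  · intro x hx
    have hp : 0 < d^2 + (c^2 - d^2) * Real.sin x ^ 2 := by positivity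
    have := (((((Real.hasDerivAt_sin x).pow 2).const_mul (c^2-d^2)).const_add (d^2)).sqrt hp.ne')
    have e : (c^2 - d^2) * Real.sin x * Real.cos x / Ysub c d x =
        (c ^ 2 - d ^ 2) * (((2:ℕ):ℝ) * Real.sin x ^ (2 - 1) * Real.cos x) /
          (2 * √(d ^ 2 + (c ^ 2 - d ^ 2) * (Real.sin ^ 2) x)) := by
      have h3 := (Real.sqrt_pos.2 hp).ne'
      simp only [Pi.pow_apply, Ysub]
      push_cast
      field_simp
    rw [e]
    exact this
  · intro x hx
    have hs : 0 < Real.sin x := Real.sin_pos_of_pos_of_lt_pi hx.1 (by linarith [hx.2, Real.pi_pos])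
    have hc : 0 < Real.cos x := Real.cos_pos_of_mem_Ioo ⟨by linarith [hx.1, Real.pi_pos], hx.2⟩
    have hY : 0 < Ysub c d x := hd.trans_le (le_Ysub hd hdc x)
    positivity

lemma sqrt_Y1 (hd : 0 < d) (hdc : d < c) {x : ℝ} (hs : 0 ≤ Real.sin x) :
    Real.sqrt (Ysub c d x ^ 2 - d^2) = Real.sqrt (c^2 - d^2) * Real.sin x := by
  rw [Ysub_sq hd hdc, add_sub_cancel_left, Real.sqrt_mul (q_pos hd hdc).le, Real.sqrt_sq hs]

lemma sqrt_Y2 (hd : 0 < d) (hdc : d < c) {x : ℝ} (hs : 0 ≤ Real.cos x) :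
    Real.sqrt (c^2 - Ysub c d x ^ 2) = Real.sqrt (c^2 - d^2) * Real.cos x := by
  rw [Ysub_sq hd hdc]
  have : c^2 - (d^2 + (c^2 - d^2) * Real.sin x ^ 2) = (c^2-d^2) * Real.cos x ^ 2 := by
    rw [Real.cos_sq']; ring
  rw [this, Real.sqrt_mul (q_pos hd hdc).le, Real.sqrt_sq hs]

lemma Bg_eq (hd : 0 < d) (hdc : d < c) :
    Bg c d = 24 * ∫ x in (0:ℝ)..(Real.pi/2),
      (Ysub c d x ^ 2 - mu2 c d) * ((c^2-d^2) * Real.sin x ^ 2) / Ysub c d x := by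
  unfold Bg
  congr 1
  apply cov_Y hd hdc
  intro x hx
  have hs : 0 < Real.sin x := Real.sin_pos_of_pos_of_lt_pi hx.1 (by linarith [hx.2, Real.pi_pos])
  have hc : 0 < Real.cos x := Real.cos_pos_of_mem_Ioo ⟨by linarith [hx.1, Real.pi_pos], hx.2⟩
  have hY : 0 < Ysub c d x := hd.trans_le (le_Ysub hd hdc x)
  have hq := Real.sqrt_pos.2 (q_pos hd hdc)
  rw [sqrt_Y1 hd hdc hs.le, sqrt_Y2 hd hdc hc.le]
  field_simp

lemma I2_eq (hd : 0 < d) (hdc : d < c) :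
    I2 c d = ∫ x in (0:ℝ)..(Real.pi/2),
      (Real.log (c / (2 * Real.sqrt (c^2-d^2))) - Real.log (Real.cos x)) / Ysub c d x := by
  unfold I2
  apply cov_Y hd hdc
  intro x hx
  have hs : 0 < Real.sin x := Real.sin_pos_of_pos_of_lt_pi hx.1 (by linarith [hx.2, Real.pi_pos])
  have hc : 0 < Real.cos x := Real.cos_pos_of_mem_Ioo ⟨by linarith [hx.1, Real.pi_pos], hx.2⟩
  have hY : 0 < Ysub c d x := hd.trans_le (le_Ysub hd hdc x)
  have hq := Real.sqrt_pos.2 (q_pos hd hdc)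
  have hc0 : 0 < c := hd.trans hdc
  have hle : 0 ≤ c^2 - Ysub c d x ^ 2 := by
    have := Ysub_le hd hdc x
    nlinarith
  rw [Real.sqrt_mul hle, sqrt_Y1 hd hdc hs.le, sqrt_Y2 hd hdc hc.le]
  rw [← Real.log_div (by positivity) hc.ne']
  have e : c / (2 * (√(c ^ 2 - d ^ 2) * Real.cos x)) = c / (2 * √(c ^ 2 - d ^ 2)) / Real.cos x := by
    field_simp
  rw [e]
  have hqq : c^2 - d^2 = √(c ^ 2 - d ^ 2) * √(c ^ 2 - d ^ 2) :=
    (Real.mul_self_sqrt (q_pos hd hdc).le).symm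
  generalize Real.log (c / (2 * √(c ^ 2 - d ^ 2)) / Real.cos x) = L
  generalize √(c ^ 2 - d ^ 2) = r at *
  rw [hqq]
  field_simp

lemma I1_eq (hd : 0 < d) (hdc : d < c) :
    I1 c d = ∫ x in (0:ℝ)..(Real.pi/2), 1 / Real.sqrt (c^2 - d^2 * Real.sin x ^ 2) := by
  unfold I1
  have key := cov_aux (fun x => d * Real.sin x) (fun x => d * Real.cos x)
    (fun y => 1 / Real.sqrt ((c^2 - y^2) * (d^2 - y^2)))
    (fun x => 1 / Real.sqrt (c^2 - d^2 * Real.sin x ^ 2)) 0 (Real.pi/2) (by positivity)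
    (by fun_prop) (fun x _ => (Real.hasDerivAt_sin x).const_mul d) ?_ ?_
  · simpa using key
  · intro x hx
    have hc : 0 < Real.cos x := Real.cos_pos_of_mem_Ioo ⟨by linarith [hx.1, Real.pi_pos], hx.2⟩
    positivity
  · intro x hx
    have hc : 0 < Real.cos x := Real.cos_pos_of_mem_Ioo ⟨by linarith [hx.1, Real.pi_pos], hx.2⟩
    have e1 : d^2 - (d * Real.sin x)^2 = (d * Real.cos x)^2 := by
      rw [mul_pow d (Real.cos x), Real.cos_sq']; ring
    have e2 : 0 < c^2 - (d * Real.sin x)^2 := by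
      have : c^2 - (d * Real.sin x)^2 = (c^2 - d^2) + (d^2 - (d * Real.sin x)^2) := by ring
      rw [this, e1]
      have := q_pos hd hdc
      positivity
    rw [e1, Real.sqrt_mul e2.le, Real.sqrt_sq (by positivity), ← mul_pow]
    have := Real.sqrt_pos.2 e2
    field_simp

end
section
variable {c d : ℝ}

lemma integral_log_cos_aux :
    ∫ x in (0:ℝ)..(Real.pi/2), Real.log (Real.cos x) = -Real.log 2 * Real.pi / 2 := by
  have h := intervalIntegral.integral_comp_sub_left (a := 0) (b := Real.pi/2)
    (fun x ↦ Real.log (Real.sin x)) (Real.pi / 2)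
  simp only [Real.sin_pi_div_two_sub, sub_self, sub_zero] at h
  rw [h, integral_log_sin_zero_pi_div_two]

lemma Bg_le (hd : 0 < d) (hdc : d < c) (hmu : mu2 c d ≤ d^2) :
    0 ≤ Bg c d ∧ Bg c d ≤ 6 * Real.pi * (c^2 - mu2 c d) * (c^2 - d^2) / d := by
  have hq := q_pos hd hdc
  have hpi : (0:ℝ) ≤ Real.pi/2 := by positivity
  have hYp : ∀ x, 0 < Ysub c d x := fun x => hd.trans_le (le_Ysub hd hdc x)
  have hY2 : ∀ x, mu2 c d ≤ Ysub c d x ^ 2 := fun x => by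
    have := le_Ysub hd hdc x
    nlinarith
  have hcontY := Ysub_cont c d
  rw [Bg_eq hd hdc]
  constructor
  · apply mul_nonneg (by norm_num)
    apply intervalIntegral.integral_nonneg hpi
    intro x _
    have := hYp x
    have := sub_nonneg.2 (hY2 x)
    positivity
  · have h1 : ∫ x in (0:ℝ)..(Real.pi/2),
        (Ysub c d x ^ 2 - mu2 c d) * ((c^2-d^2) * Real.sin x ^ 2) / Ysub c d x ≤
        ∫ x in (0:ℝ)..(Real.pi/2), ((c^2 - mu2 c d) * (c^2-d^2) / d) * Real.sin x ^ 2 := by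
      apply intervalIntegral.integral_mono_on hpi
      · apply Continuous.intervalIntegrable
        exact Continuous.div (by fun_prop) hcontY (fun x => (hYp x).ne')
      · apply Continuous.intervalIntegrable
        fun_prop
      · intro x _
        have h0 := hYp x
        have h2 := sub_nonneg.2 (hY2 x)
        have h3 : Ysub c d x ^ 2 ≤ c^2 := by
          have := Ysub_le hd hdc x
          nlinarith
        calc (Ysub c d x ^ 2 - mu2 c d) * ((c^2-d^2) * Real.sin x ^ 2) / Ysub c d x
            ≤ (c ^ 2 - mu2 c d) * ((c^2-d^2) * Real.sin x ^ 2) / d := by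
              have : 0 ≤ c^2 - mu2 c d := by linarith
              have := le_Ysub hd hdc x
              gcongr
          _ = _ := by ring
    rw [intervalIntegral.integral_const_mul, integral_sin_sq] at h1
    simp only [Real.sin_zero, Real.cos_zero, Real.cos_pi_div_two] at h1
    calc _ ≤ 24 * ((c ^ 2 - mu2 c d) * (c ^ 2 - d ^ 2) / d *
          ((0 * 1 - Real.sin (Real.pi / 2) * 0 + Real.pi / 2 - 0) / 2)) := by linarith
      _ = _ := by ring

/-- Bounds for `I₂`, with `Λ = log (c/√(c²-d²))`. -/
lemma I2_bounds (hd : 0 < d) (hdc : d < c)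
    (hL : Real.log 2 ≤ Real.log (c / Real.sqrt (c^2-d^2))) :
    Real.pi / 2 * Real.log (c / Real.sqrt (c^2-d^2)) / c ≤ I2 c d ∧
    I2 c d ≤ Real.pi / 2 * Real.log (c / Real.sqrt (c^2-d^2)) / d := by
  have hq := Real.sqrt_pos.2 (q_pos hd hdc)
  have hc0 : 0 < c := hd.trans hdc
  have hpi : (0:ℝ) ≤ Real.pi/2 := by positivity
  have hYp : ∀ x, 0 < Ysub c d x := fun x => hd.trans_le (le_Ysub hd hdc x)
  have hcontY := Ysub_cont c d
  have hlog : Real.log (c / (2 * Real.sqrt (c^2-d^2))) =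
      Real.log (c / Real.sqrt (c^2-d^2)) - Real.log 2 := by
    rw [← Real.log_div (by positivity) (by norm_num)]
    congr 1
    field_simp
  rw [I2_eq hd hdc, hlog]
  generalize Real.log (c / Real.sqrt (c^2-d^2)) = Λ at *
  have hint : IntervalIntegrable (fun x => Λ - Real.log 2 - Real.log (Real.cos x))
      MeasureTheory.volume 0 (Real.pi/2) := by
    apply IntervalIntegrable.sub intervalIntegrable_const
    exact intervalIntegrable_log_cos
  have hval : ∫ x in (0:ℝ)..(Real.pi/2), (Λ - Real.log 2 - Real.log (Real.cos x)) =
      Real.pi / 2 * Λ := by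
    have hlc : IntervalIntegrable (fun x => Real.log (Real.cos x))
      MeasureTheory.volume 0 (Real.pi/2) := intervalIntegrable_log_cos
    rw [intervalIntegral.integral_sub intervalIntegrable_const hlc,
      integral_log_cos_aux, intervalIntegral.integral_const]
    simp only [smul_eq_mul]
    ring
  have hint2 : IntervalIntegrable (fun x => (Λ - Real.log 2 - Real.log (Real.cos x)) / Ysub c d x)
      MeasureTheory.volume 0 (Real.pi/2) := by
    have : Continuous (fun x => (Ysub c d x)⁻¹) := hcontY.inv₀ (fun x => (hYp x).ne')
    simpa [div_eq_mul_inv] using hint.mul_continuousOn this.continuousOn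
  have hnn : ∀ x, 0 ≤ Λ - Real.log 2 - Real.log (Real.cos x) := fun x => by
    have : Real.log (Real.cos x) ≤ 0 := by
      rw [← Real.log_abs]
      exact Real.log_nonpos (abs_nonneg _) (Real.abs_cos_le_one x)
    linarith
  constructor
  · rw [← hval, ← intervalIntegral.integral_div]
    apply intervalIntegral.integral_mono_on hpi (hint.div_const c) hint2
    intro x _
    have := hnn x
    have := hYp x
    have := Ysub_le hd hdc x
    gcongr
  · rw [← hval, ← intervalIntegral.integral_div]
    apply intervalIntegral.integral_mono_on hpi hint2 (hint.div_const d)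
    intro x _
    have := hnn x
    have := le_Ysub hd hdc x
    gcongr

lemma I1_bounds (hd : 0 < d) (hdc : d < c) :
    Real.log (c / Real.sqrt (c^2-d^2)) / d ≤ I1 c d ∧
    I1 c d ≤ (Real.log (c / Real.sqrt (c^2-d^2)) + 3) / d := by
  have hq0 := q_pos hd hdc
  have hq := Real.sqrt_pos.2 hq0
  have hc0 : 0 < c := hd.trans hdc
  have hpi : (0:ℝ) ≤ Real.pi/2 := by positivity
  have hr : ∀ x, c^2 - d^2 * Real.sin x ^2 = (c^2-d^2) + d^2 * Real.cos x ^2 := fun x => by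
    rw [Real.cos_sq']; ring
  have hrp : ∀ x, 0 < c^2 - d^2 * Real.sin x ^2 := fun x => by
    rw [hr]; positivity
  have hcont : Continuous (fun x => Real.sqrt (c^2 - d^2 * Real.sin x ^2)) := by fun_prop
  have hsp : ∀ x, 0 < Real.sqrt (c^2 - d^2 * Real.sin x ^2) := fun x => Real.sqrt_pos.2 (hrp x)
  have hi1 : Continuous (fun x => 1 / Real.sqrt (c^2 - d^2 * Real.sin x ^2)) :=
    continuous_const.div hcont (fun x => (hsp x).ne')
  have hi2 : Continuous (fun x => Real.sin x / Real.sqrt (c^2 - d^2 * Real.sin x ^2)) :=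
    Real.continuous_sin.div hcont (fun x => (hsp x).ne')
  have hval : ∫ x in (0:ℝ)..(Real.pi/2), Real.sin x / Real.sqrt (c^2 - d^2 * Real.sin x ^2) =
      Real.log ((c + d) / Real.sqrt (c^2-d^2)) / d := by
    have hder : ∀ x ∈ Set.uIcc (0:ℝ) (Real.pi/2), HasDerivAt
        (fun x => -(Real.arsinh (d / Real.sqrt (c^2-d^2) * Real.cos x)) / d)
        (Real.sin x / Real.sqrt (c^2 - d^2 * Real.sin x ^2)) x := by
      intro x _
      have h := ((((Real.hasDerivAt_cos x).const_mul
        (d / Real.sqrt (c^2-d^2))).arsinh).neg).div_const d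
      have e : 1 + (d / Real.sqrt (c^2-d^2) * Real.cos x)^2 =
          (c^2 - d^2 * Real.sin x ^2) / (c^2-d^2) := by
        rw [mul_pow, div_pow, Real.sq_sqrt hq0.le, hr]
        field_simp
      rw [e, Real.sqrt_div (hrp x).le] at h
      refine h.congr_deriv ?_
      have := hsp x
      simp only [smul_eq_mul]
      field_simp
      try ring
    rw [intervalIntegral.integral_eq_sub_of_hasDerivAt hder (hi2.intervalIntegrable _ _)]
    simp only [Real.cos_pi_div_two, Real.cos_zero, mul_zero, mul_one, Real.arsinh_zero]
    have e : Real.arsinh (d / Real.sqrt (c^2-d^2)) = Real.log ((c + d) / Real.sqrt (c^2-d^2)) := by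
      unfold Real.arsinh
      congr 1
      have : 1 + (d / Real.sqrt (c^2-d^2))^2 = c^2 / (c^2-d^2) := by
        rw [div_pow, Real.sq_sqrt hq0.le]
        field_simp
        ring
      rw [this, Real.sqrt_div (by positivity), Real.sqrt_sq hc0.le]
      ring
    rw [e]
    ring
  rw [I1_eq hd hdc]
  constructor
  · calc Real.log (c / Real.sqrt (c^2-d^2)) / d
        ≤ Real.log ((c + d) / Real.sqrt (c^2-d^2)) / d := by
          have : c ≤ c + d := by linarith
          gcongr
      _ ≤ _ := by
        rw [← hval]
        apply intervalIntegral.integral_mono_on hpi (hi2.intervalIntegrable _ _)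
          (hi1.intervalIntegrable _ _)
        intro x _
        have := hsp x
        have := Real.sin_le_one x
        gcongr
  · have h1 : ∫ x in (0:ℝ)..(Real.pi/2), 1 / Real.sqrt (c^2 - d^2 * Real.sin x ^2) ≤
        ∫ x in (0:ℝ)..(Real.pi/2),
          (Real.sin x / Real.sqrt (c^2 - d^2 * Real.sin x ^2) + 1 / d) := by
      apply intervalIntegral.integral_mono_on hpi (hi1.intervalIntegrable _ _)
          ((hi2.add continuous_const).intervalIntegrable _ _)
      intro x hx
      have h2 := hsp x
      have hs : 0 ≤ Real.sin x :=
        Real.sin_nonneg_of_nonneg_of_le_pi hx.1 (by linarith [hx.2, Real.pi_pos])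
      have hc : 0 ≤ Real.cos x :=
        Real.cos_nonneg_of_mem_Icc ⟨by linarith [hx.1, Real.pi_pos], hx.2⟩
      have h3 : d * (1 - Real.sin x) ≤ Real.sqrt (c^2 - d^2 * Real.sin x ^2) := by
        apply Real.le_sqrt_of_sq_le
        have : (1 - Real.sin x)^2 ≤ Real.cos x ^2 := by
          rw [Real.cos_sq']
          nlinarith [Real.sin_le_one x]
        rw [hr, mul_pow]
        nlinarith [mul_le_mul_of_nonneg_left this (sq_nonneg d)]
      have h4 : 1 / Real.sqrt (c^2 - d^2 * Real.sin x ^2)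
          - Real.sin x / Real.sqrt (c^2 - d^2 * Real.sin x ^2) ≤ 1 / d := by
        rw [← sub_div, div_le_div_iff₀ h2 hd]
        linarith
      show _ ≤ Real.sin x / Real.sqrt (c^2 - d^2 * Real.sin x ^2) + 1 / d
      linarith
    rw [intervalIntegral.integral_add (hi2.intervalIntegrable _ _) intervalIntegrable_const,
      hval, intervalIntegral.integral_const] at h1
    refine h1.trans ?_
    have h5 : Real.log ((c + d) / Real.sqrt (c^2-d^2)) ≤
        Real.log (c / Real.sqrt (c^2-d^2)) + 1 := by
      have : Real.log 2 ≤ 1 := by linarith [Real.log_two_lt_d9]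
      calc Real.log ((c + d) / Real.sqrt (c^2-d^2)) ≤ Real.log (2 * (c / Real.sqrt (c^2-d^2))) := by
            rw [← mul_div_assoc]
            have : c + d ≤ 2 * c := by linarith
            gcongr
        _ = Real.log 2 + Real.log (c / Real.sqrt (c^2-d^2)) :=
            Real.log_mul (by norm_num) (by positivity)
        _ ≤ _ := by linarith
    rw [smul_eq_mul, mul_one_div, ← add_div]
    apply div_le_div_of_nonneg_right _ hd.le
    linarith [Real.pi_lt_d2]

end
section
variable {c d : ℝ}

lemma w_cont (hd : 0 < d) (hdc : d < c) :
    ContinuousOn (fun y => Real.sqrt ((d^2 - y^2) / (c^2 - y^2))) (Set.Icc 0 d) := by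
  apply ContinuousOn.sqrt
  apply ContinuousOn.div (by fun_prop) (by fun_prop)
  intro y hy
  have h1 := hy.1
  have h2 := hy.2
  nlinarith

lemma w_int (hd : 0 < d) (hdc : d < c) (p : ℝ → ℝ) (hp : Continuous p) :
    IntervalIntegrable (fun y => p y * Real.sqrt ((d^2 - y^2) / (c^2 - y^2)))
      MeasureTheory.volume 0 d := by
  apply ContinuousOn.intervalIntegrable
  rw [Set.uIcc_of_le hd.le]
  exact hp.continuousOn.mul (w_cont hd hdc)

lemma w_int' (hd : 0 < d) (hdc : d < c) :
    IntervalIntegrable (fun y => Real.sqrt ((d^2 - y^2) / (c^2 - y^2)))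
      MeasureTheory.volume 0 d := by
  simpa using w_int hd hdc (fun _ => 1) continuous_const

lemma w_pos (hd : 0 < d) (hdc : d < c) :
    0 < ∫ y in (0:ℝ)..d, Real.sqrt ((d^2 - y^2) / (c^2 - y^2)) := by
  apply intervalIntegral.intervalIntegral_pos_of_pos_on (w_int' hd hdc) _ hd
  intro y hy
  apply Real.sqrt_pos.2
  have h1 := hy.1
  have h2 := hy.2
  apply div_pos <;> nlinarith

lemma w_le_one (hd : 0 < d) (hdc : d < c) {y : ℝ} (hy : y ∈ Set.Icc 0 d) :
    Real.sqrt ((d^2 - y^2) / (c^2 - y^2)) ≤ 1 := by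
  have h1 := hy.1
  have h2 := hy.2
  rw [Real.sqrt_le_left zero_le_one, one_pow, div_le_one (by nlinarith)]
  nlinarith

lemma mu2_sub (hd : 0 < d) (hdc : d < c) (A : ℝ) :
    ∫ y in (0:ℝ)..d, (A - y^2) * Real.sqrt ((d^2 - y^2) / (c^2 - y^2)) =
      (A - mu2 c d) * ∫ y in (0:ℝ)..d, Real.sqrt ((d^2 - y^2) / (c^2 - y^2)) := by
  have h := w_pos hd hdc
  have e : (A - mu2 c d) * ∫ y in (0:ℝ)..d, Real.sqrt ((d^2 - y^2) / (c^2 - y^2)) =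
    A * (∫ y in (0:ℝ)..d, Real.sqrt ((d^2 - y^2) / (c^2 - y^2))) -
      ∫ y in (0:ℝ)..d, y^2 * Real.sqrt ((d^2 - y^2) / (c^2 - y^2)) := by
    unfold mu2
    rw [sub_mul, div_mul_cancel₀ _ h.ne']
  rw [e, ← intervalIntegral.integral_const_mul,
    ← intervalIntegral.integral_sub ((w_int' hd hdc).const_mul A)
      (w_int hd hdc (fun y => y^2) (by fun_prop))]
  congr 1
  ext y
  ring

lemma mu2_le (hd : 0 < d) (hdc : d < c) : mu2 c d ≤ d^2/3 := by
  have hw := w_pos hd hdc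
  have h := mu2_sub hd hdc (d^2/3)
  suffices h2 : 0 ≤ ∫ y in (0:ℝ)..d, (d^2/3 - y^2) * Real.sqrt ((d^2 - y^2) / (c^2 - y^2)) by
    rw [h] at h2
    have := nonneg_of_mul_nonneg_left h2 hw
    linarith
  set W := Real.sqrt ((d^2 - d^2/3) / (c^2 - d^2/3)) with hW
  have h0 : ∫ y in (0:ℝ)..d, (d^2/3 - y^2) * W = 0 := by
    rw [intervalIntegral.integral_mul_const, intervalIntegral.integral_sub
      intervalIntegrable_const ((continuous_pow 2).intervalIntegrable _ _), integral_pow,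
      intervalIntegral.integral_const, smul_eq_mul]
    norm_num
    left
    ring
  refine h0.symm.le.trans ?_
  apply intervalIntegral.integral_mono_on hd.le
    (Continuous.intervalIntegrable (by fun_prop) _ _) (w_int hd hdc _ (by fun_prop))
  intro y hy
  have h1 := hy.1
  have h2 := hy.2
  have hp : 0 < c^2 - y^2 := by nlinarith
  have hp2 : 0 < c^2 - d^2/3 := by nlinarith
  have hq := q_pos hd hdc
  rcases le_total (y^2) (d^2/3) with hle | hle
  · have : W ≤ Real.sqrt ((d^2 - y^2) / (c^2 - y^2)) := by
      apply Real.sqrt_le_sqrt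
      rw [div_le_div_iff₀ hp2 hp]
      nlinarith
    exact mul_le_mul_of_nonneg_left this (by linarith)
  · have : Real.sqrt ((d^2 - y^2) / (c^2 - y^2)) ≤ W := by
      apply Real.sqrt_le_sqrt
      rw [div_le_div_iff₀ hp hp2]
      nlinarith
    exact mul_le_mul_of_nonpos_left this (by linarith)

lemma integral_inv_sq (hd : 0 < d) (hdc : d < c) :
    IntervalIntegrable (fun y => 1 / (c^2 - y^2)) MeasureTheory.volume 0 d ∧
    Real.log (c / Real.sqrt (c^2-d^2)) / c ≤ ∫ y in (0:ℝ)..d, 1 / (c^2 - y^2) := by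
  have hc0 : 0 < c := hd.trans hdc
  have hq0 := q_pos hd hdc
  have hi : IntervalIntegrable (fun y => 1 / (c^2 - y^2)) MeasureTheory.volume 0 d := by
    apply ContinuousOn.intervalIntegrable
    rw [Set.uIcc_of_le hd.le]
    apply ContinuousOn.div (by fun_prop) (by fun_prop)
    intro y hy
    have h1 := hy.1
    have h2 := hy.2
    nlinarith
  refine ⟨hi, ?_⟩
  have hder : ∀ y ∈ Set.uIcc (0:ℝ) d, HasDerivAt
      (fun y => (Real.log (c + y) - Real.log (c - y)) / (2*c)) (1 / (c^2 - y^2)) y := by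
    intro y hy
    rw [Set.uIcc_of_le hd.le] at hy
    have h1 := hy.1
    have h2 := hy.2
    have p1 : 0 < c + y := by linarith
    have p2 : 0 < c - y := by linarith
    have := ((((hasDerivAt_id y).const_add c).log p1.ne').sub
      (((hasDerivAt_id y).const_sub c).log p2.ne')).div_const (2*c)
    refine this.congr_deriv ?_
    have : c^2 - y^2 = (c+y)*(c-y) := by ring
    rw [this]
    simp only [id]
    field_simp
    ring
  rw [intervalIntegral.integral_eq_sub_of_hasDerivAt hder hi]
  have p2 : 0 < c - d := by linarith
  have e : Real.log (c / Real.sqrt (c^2-d^2)) = Real.log c - (Real.log (c+d) + Real.log (c-d))/2 := by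
    rw [Real.log_div hc0.ne' (Real.sqrt_pos.2 hq0).ne', Real.log_sqrt hq0.le,
      ← Real.log_mul (by positivity) (by positivity)]
    congr 3
    ring
  rw [e]
  have h1 : Real.log c ≤ Real.log (c + d) := Real.log_le_log hc0 (by linarith)
  simp only [add_zero, sub_zero, sub_self, zero_div]
  rw [div_le_div_iff₀ hc0 (by positivity)]
  nlinarith

lemma mu2_upper (hd : 0 < d) (hdc : d < c) (hL : 3 ≤ Real.log (c / Real.sqrt (c^2-d^2))) :
    (c^2 - d^2) * (Real.log (c / Real.sqrt (c^2-d^2)) - 3) ≤ 3 * (c^2/3 - mu2 c d) := by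
  have hc0 : 0 < c := hd.trans hdc
  have hq0 := q_pos hd hdc
  have hw := w_pos hd hdc
  have h := mu2_sub hd hdc (c^2/3)
  obtain ⟨hi, hlow⟩ := integral_inv_sq hd hdc
  have hwle : ∫ y in (0:ℝ)..d, Real.sqrt ((d^2 - y^2) / (c^2 - y^2)) ≤ c := by
    calc _ ≤ ∫ y in (0:ℝ)..d, (1:ℝ) :=
          intervalIntegral.integral_mono_on hd.le (w_int' hd hdc) intervalIntegrable_const
            (fun y hy => w_le_one hd hdc hy)
      _ = d := by simp
      _ ≤ c := hdc.le
  set q := c^2 - d^2 with hqdef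
  set Λ := Real.log (c / Real.sqrt q) with hΛ
  have hmain : ∫ y in (0:ℝ)..d, ((c^2/3 - y^2) + ((c^2/3*q) * (1 / (c^2 - y^2)) - q)) ≤
      ∫ y in (0:ℝ)..d, (c^2/3 - y^2) * Real.sqrt ((d^2 - y^2) / (c^2 - y^2)) := by
    apply intervalIntegral.integral_mono_on hd.le _ (w_int hd hdc _ (by fun_prop))
    · intro y hy
      have h1 := hy.1
      have h2 := hy.2
      have hp : 0 < c^2 - y^2 := by nlinarith
      have hw1 := w_le_one hd hdc hy
      have hw0 := Real.sqrt_nonneg ((d^2 - y^2) / (c^2 - y^2))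
      have hsq : Real.sqrt ((d^2 - y^2) / (c^2 - y^2))^2 = (d^2 - y^2) / (c^2 - y^2) :=
        Real.sq_sqrt (div_nonneg (by nlinarith) hp.le)
      set w := Real.sqrt ((d^2 - y^2) / (c^2 - y^2))
      set v := 1 / (c^2 - y^2) with hv
      have hv0 : 0 < v := by positivity
      have hv1 : v * (c^2 - y^2) = 1 := by rw [hv]; field_simp
      have hsq' : (1 - w) * (1 + w) = q * v := by
        have : (1 - w) * (1 + w) = 1 - w^2 := by ring
        rw [this, hsq, hv, hqdef]
        field_simp
        ring
      have k1 : q * v / 2 ≤ 1 - w := by nlinarith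
      have k2 : 1 - w ≤ q * v := by nlinarith
      have key : (y^2 - c^2/3) * (q * v / 2) - q/2 ≤ (y^2 - c^2/3) * (1 - w) := by
        rcases le_total (y^2) (c^2/3) with hle | hle
        · have a1 : (c^2/3 - y^2) * (1 - w) ≤ (c^2/3 - y^2) * (q*v) :=
            mul_le_mul_of_nonneg_left k2 (by linarith)
          have a2 : (c^2/3 - y^2) * v ≤ 1/2 := by nlinarith
          have a3 : q * ((c^2/3 - y^2) * v) ≤ q * (1/2) := mul_le_mul_of_nonneg_left a2 hq0.le
          have a4 : 0 ≤ (c^2/3 - y^2) * (q * v / 2) :=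
            mul_nonneg (by linarith) (by positivity)
          nlinarith
        · have a1 := mul_le_mul_of_nonneg_left k1 (sub_nonneg.2 hle)
          linarith
      have e : (y^2 - c^2/3) * (q * v / 2) = c^2/3*q*v - q/2 := by
        have : (y^2 - c^2/3) * (q * v / 2) = c^2/3*q*v - q/2 * (v * (c^2 - y^2)) := by ring
        rw [this, hv1]; ring
      rw [e] at key
      nlinarith
    · exact ((Continuous.intervalIntegrable (by fun_prop) _ _)).add
        ((hi.const_mul _).sub intervalIntegrable_const)
  rw [h, intervalIntegral.integral_add (Continuous.intervalIntegrable (by fun_prop) _ _)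
    ((hi.const_mul _).sub intervalIntegrable_const),
    intervalIntegral.integral_sub (hi.const_mul _) intervalIntegrable_const,
    intervalIntegral.integral_sub
      intervalIntegrable_const ((continuous_pow 2).intervalIntegrable _ _), integral_pow,
      intervalIntegral.integral_const, intervalIntegral.integral_const,
      intervalIntegral.integral_const_mul] at hmain
  simp only [smul_eq_mul] at hmain
  have hlow2 : c/3 * q * Λ ≤ (c^2/3*q) * ∫ y in (0:ℝ)..d, 1 / (c^2 - y^2) := by
    calc c/3 * q * Λ = (c^2/3*q) * (Λ / c) := by field_simp
      _ ≤ _ := by gcongr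
  have h3 : (0:ℝ) ≤ (d - 0) * (c^2/3) - (d^(2+1) - 0^(2+1)) / ((2:ℕ)+1) := by
    have : (d - 0) * (c^2/3) - (d^(2+1) - 0^(2+1)) / (((2:ℕ):ℝ)+1) = d * q / 3 := by
      push_cast; rw [hqdef]; ring
    rw [this]; positivity
  have h4 : c/3 * (q * (Λ - 3)) ≤ (c^2/3 - mu2 c d) *
      ∫ y in (0:ℝ)..d, Real.sqrt ((d^2 - y^2) / (c^2 - y^2)) := by
    have : d * q ≤ c * q := by gcongr
    linarith
  have h5 : 0 ≤ c^2/3 - mu2 c d := by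
    have := mu2_le hd hdc
    linarith
  have h6 : c/3 * (q * (Λ - 3)) ≤ (c^2/3 - mu2 c d) * c :=
    h4.trans (mul_le_mul_of_nonneg_left hwle h5)
  have h7 : c * (q * (Λ - 3)) ≤ c * (3 * (c^2/3 - mu2 c d)) := by linarith
  exact le_of_mul_le_mul_left h7 hc0

end
section
open Filter Topology

/-- The scale controlling `c² - d²`. -/
noncomputable def hsc (c t : ℝ) : ℝ := Real.log t / (c * t)

noncomputable def Lsc (c t : ℝ) : ℝ := Real.log (c^2 / hsc c t) / 2

lemma hsc_tendsto {c : ℝ} (hc : 0 < c) : Tendsto (hsc c) atTop (𝓝 0) := by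
  have h := Real.isLittleO_log_id_atTop.tendsto_div_nhds_zero
  have h2 := h.const_mul (1/c)
  rw [mul_zero] at h2
  refine h2.congr (fun t => ?_)
  unfold hsc
  simp only [id]
  rw [div_mul_div_comm, one_mul]

lemma hsc_pos {c t : ℝ} (hc : 0 < c) (ht : 1 < t) : 0 < hsc c t := by
  have := Real.log_pos ht
  unfold hsc
  positivity

lemma Lsc_tendsto {c : ℝ} (hc : 0 < c) : Tendsto (Lsc c) atTop atTop := by
  apply Tendsto.atTop_div_const (by norm_num)
  apply Real.tendsto_log_atTop.comp
  have h1 : Tendsto (hsc c) atTop (𝓝[>] 0) := by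
    rw [tendsto_nhdsWithin_iff]
    refine ⟨hsc_tendsto hc, ?_⟩
    filter_upwards [eventually_gt_atTop 1] with t ht
    exact hsc_pos hc ht
  have h2 := h1.inv_tendsto_nhdsGT_zero.const_mul_atTop (show 0 < c^2 by positivity)
  exact h2.congr (fun t => by simp [div_eq_mul_inv])

lemma log_div_Lsc_tendsto {c : ℝ} (hc : 0 < c) :
    Tendsto (fun t => Real.log t / (Lsc c t - 3)) atTop (𝓝 2) := by
  have hll : Tendsto (fun t => Real.log (Real.log t) / Real.log t) atTop (𝓝 0) :=
    (Real.isLittleO_log_id_atTop.tendsto_div_nhds_zero).comp Real.tendsto_log_atTop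
  have hk : Tendsto (fun t => (3 * Real.log c - 6) / Real.log t) atTop (𝓝 0) :=
    Real.tendsto_log_atTop.const_div_atTop _
  have h1 : Tendsto (fun t => (1 + (3 * Real.log c - 6) / Real.log t
      - Real.log (Real.log t) / Real.log t) / 2) atTop (𝓝 ((1 + 0 - 0)/2)) :=
    ((hk.const_add 1).sub hll).div_const 2
  have h2 := h1.inv₀ (by norm_num)
  have : (((1:ℝ) + 0 - 0)/2)⁻¹ = 2 := by norm_num
  rw [this] at h2
  refine h2.congr' ?_
  filter_upwards [eventually_gt_atTop 1] with t ht
  have hl := Real.log_pos ht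
  have e : Lsc c t = (3 * Real.log c + Real.log t - Real.log (Real.log t)) / 2 := by
    unfold Lsc hsc
    congr 1
    have ht0 : 0 < t := by linarith
    have : c^2 / (Real.log t / (c*t)) = c^3 * t / Real.log t := by field_simp
    rw [this, Real.log_div (by positivity) hl.ne', Real.log_mul (by positivity) ht0.ne',
      Real.log_pow]
    push_cast
    ring
  rw [e]
  rw [← inv_div]
  congr 1
  field_simp
  ring

lemma F_tendsto {c : ℝ} (hc : 0 < c) (ε : ℝ) :
    Tendsto (fun t => 6 * (2*c^2/3 + hsc c t) / Real.sqrt (c^2 - hsc c t) *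
        ((1-ε) / (8*c) * (Real.log t / (Lsc c t - 3)))
      - 1/2 * (Real.sqrt (c^2 - hsc c t) / c) * (Lsc c t / (Lsc c t + 3))) atTop
      (𝓝 (1/2 - ε)) := by
  have hh := hsc_tendsto hc
  have hD : Tendsto (fun t => Real.sqrt (c^2 - hsc c t)) atTop (𝓝 c) := by
    have := (hh.const_sub (c^2)).sqrt
    rwa [sub_zero, Real.sqrt_sq hc.le] at this
  have hL : Tendsto (fun t => Lsc c t / (Lsc c t + 3)) atTop (𝓝 1) := by
    have h3 : Tendsto (fun t => Lsc c t + 3) atTop atTop :=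
      tendsto_atTop_add_const_right _ _ (Lsc_tendsto hc)
    have h4 := (h3.const_div_atTop 3).const_sub 1
    rw [sub_zero] at h4
    refine h4.congr' ?_
    filter_upwards [h3.eventually_gt_atTop 0] with t ht
    field_simp
    ring
  have h := (((((hh.const_add (2*c^2/3)).const_mul 6).div hD hc.ne').mul
    ((log_div_Lsc_tendsto hc).const_mul ((1-ε)/(8*c)))).sub
    (((hD.div_const c).const_mul (1/2)).mul hL))
  have e : 6 * (2 * c ^ 2 / 3 + 0) / c * ((1 - ε) / (8 * c) * 2) - 1 / 2 * (c / c) * 1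
      = 1/2 - ε := by
    field_simp
    ring
  rw [e] at h
  exact h

end

section
open Filter Topology

lemma zbound {c d μ t ε Λ h L D b i1 i2 q s lt : ℝ} (hc : 0 < c) (hd : 0 < d) (hD0 : 0 < D)
    (hDd : D ≤ d) (hL : 4 ≤ L) (hLΛ : L ≤ Λ) (ht : 0 < t) (hq : 0 < q)
    (hε : ε < 1) (hlt : 0 < lt)
    (hs : s ≤ h) (hh : 0 < h)
    (hmu : c^2 - μ ≤ 2*c^2/3 + s) (hmu0 : 0 ≤ c^2 - μ)
    (hqt : q * (Λ - 3) * t ≤ (1-ε) * lt / (8*c))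
    (hb0 : 0 ≤ b) (hb : b ≤ 6 * Real.pi * (c^2 - μ) * q / d)
    (hi2 : Real.pi / 2 * Λ / c ≤ i2) (hi2' : i2 ≤ Real.pi/2 * Λ / d)
    (hi1 : Λ / d ≤ i1) (hi1' : i1 ≤ (Λ + 3) / d)
    (hF : 6 * (2*c^2/3 + h) / D * ((1-ε) / (8*c) * (lt / (L - 3)))
      - 1/2 * (D / c) * (L / (L + 3)) < 1/2) :
    -1/2 ≤ (t * b + -i2 / i1) / Real.pi ∧ (t * b + -i2 / i1) / Real.pi ≤ 1/2 := by
  have hpi := Real.pi_pos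
  have hΛ : 0 < Λ := by linarith
  have hi1p : 0 < i1 := lt_of_lt_of_le (by positivity) hi1
  have hi2p : 0 < i2 := lt_of_lt_of_le (by positivity) hi2
  constructor
  · have h1 : i2 / i1 ≤ Real.pi / 2 := by
      rw [div_le_iff₀ hi1p]
      calc i2 ≤ Real.pi/2 * Λ / d := hi2'
        _ = Real.pi/2 * (Λ / d) := by ring
        _ ≤ _ := by gcongr
    rw [le_div_iff₀ hpi, neg_div i1 i2]
    have := mul_nonneg ht.le hb0
    linarith
  · have h1 : Real.pi / 2 * ((D / c) * (L / (L + 3))) ≤ i2 / i1 := by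
      rw [le_div_iff₀ hi1p]
      have hx : L / (L+3) ≤ Λ / (Λ+3) := by
        rw [div_le_div_iff₀ (by linarith) (by linarith)]
        nlinarith
      calc Real.pi / 2 * ((D / c) * (L / (L + 3))) * i1
          ≤ Real.pi / 2 * ((d / c) * (Λ / (Λ + 3))) * ((Λ + 3) / d) := by
            have : 0 ≤ L / (L+3) := by positivity
            gcongr
        _ = Real.pi / 2 * Λ / c := by field_simp
        _ ≤ i2 := hi2
    have h2 : t * b ≤ Real.pi * (6 * (2*c^2/3 + h) / D * ((1-ε) / (8*c) * (lt / (L - 3)))) := by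
      have hL3 : 0 < L - 3 := by linarith
      have hΛ3 : 0 < Λ - 3 := by linarith
      have h3 : t * q ≤ (1-ε) / (8*c) * (lt / (L - 3)) := by
        calc t * q ≤ ((1-ε) * lt / (8*c)) / (Λ - 3) := by
              rw [le_div_iff₀ hΛ3]
              linarith
          _ ≤ ((1-ε) * lt / (8*c)) / (L - 3) := by
              have : 0 ≤ (1-ε) := by linarith
              gcongr
          _ = _ := by ring
      calc t * b ≤ t * (6 * Real.pi * (c^2 - μ) * q / d) := by gcongr
        _ = Real.pi * (6 * (c^2 - μ) / d * (t * q)) := by ring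
        _ ≤ Real.pi * (6 * (2*c^2/3 + h) / D * ((1-ε) / (8*c) * (lt / (L - 3)))) := by
            have : c^2 - μ ≤ 2*c^2/3 + h := by linarith
            gcongr
    rw [div_le_iff₀ hpi, neg_div i1 i2]
    have h4 := mul_lt_mul_of_pos_left hF hpi
    linarith

end
theorem stmt15 (c : ℝ) (hc : 0 < c) (f : ℝ → ℝ)
    (hmap : ∀ ξ ∈ Set.Icc (-c^2/2) (c^2/3), f ξ ∈ Set.Icc 0 c)
    (hcont : ContinuousOn f (Set.Icc (-c^2/2) (c^2/3)))
    (hmono : StrictMonoOn f (Set.Icc (-c^2/2) (c^2/3)))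
    (hmod : ∀ ξ ∈ Set.Icc (-c^2/2) (c^2/3),
      c^2/2 + ξ = mu2 c (f ξ) + (f ξ)^2/2) :
    ∃ ε₀ > 0, ∀ ε : ℝ, 0 < ε → ε < ε₀ →
      ∃ T : ℝ, ∀ t : ℝ, T < t → ∀ x : ℝ,
        4*c^2*t - (1 - ε)/(2*c) * Real.log t ≤ x →
        x < 4*c^2*t →
        -1/2 ≤ zvar c f t (x/(12*t)) ∧ zvar c f t (x/(12*t)) ≤ 1/2 := by
  refine ⟨1, one_pos, fun ε hε0 hε1 => ?_⟩
  have hev : ∀ᶠ t in Filter.atTop, 1 < t ∧ hsc c t < c^2/2 ∧ 4 ≤ Lsc c t ∧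
      6 * (2*c^2/3 + hsc c t) / Real.sqrt (c^2 - hsc c t) *
        ((1-ε) / (8*c) * (Real.log t / (Lsc c t - 3)))
      - 1/2 * (Real.sqrt (c^2 - hsc c t) / c) * (Lsc c t / (Lsc c t + 3)) < 1/2 := by
    filter_upwards [Filter.eventually_gt_atTop 1,
      (hsc_tendsto hc).eventually_lt_const (show 0 < c^2/2 by positivity),
      (Lsc_tendsto hc).eventually_ge_atTop 4,
      (F_tendsto hc ε).eventually_lt_const (show 1/2 - ε < 1/2 by linarith)] with t h1 h2 h3 h4
    exact ⟨h1, h2, h3, h4⟩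
  obtain ⟨T, hT⟩ := Filter.eventually_atTop.1 hev
  refine ⟨T, fun t ht x hx1 hx2 => ?_⟩
  obtain ⟨ht1, hh, hL, hF⟩ := hT t ht.le
  have ht0 : 0 < t := by linarith
  have hlt := Real.log_pos ht1
  have hhp := hsc_pos hc ht1
  set ξ := x / (12*t) with hξ
  have hxξ : x = 12 * t * ξ := by rw [hξ]; field_simp
  have hs1 : t * (c^2/3 - ξ) ≤ (1-ε) * Real.log t / (24*c) := by
    have : (1 - ε)/(2*c) * Real.log t = 12 * ((1-ε) * Real.log t / (24*c)) := by
      field_simp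
      ring
    rw [this, hxξ] at hx1
    linarith
  have hξlt : ξ < c^2/3 := by
    rw [hxξ] at hx2
    nlinarith
  have hs2 : 24 * (c^2/3 - ξ) ≤ hsc c t := by
    have h1 : (1-ε) * Real.log t / (24*c) ≤ 1 * Real.log t / (24*c) := by
      gcongr
      linarith
    have h2 := hs1.trans h1
    unfold hsc
    rw [le_div_iff₀ (by positivity)]
    rw [le_div_iff₀ (by positivity)] at h2
    linarith
  have hmem : ξ ∈ Set.Icc (-c^2/2) (c^2/3) := by
    refine ⟨?_, hξlt.le⟩
    nlinarith [sq_nonneg c]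
  have hmem2 : c^2/3 ∈ Set.Icc (-c^2/2) (c^2/3) := ⟨by nlinarith [sq_nonneg c], le_rfl⟩
  have hdc : f ξ < c := lt_of_lt_of_le (hmono hmem hmem2 hξlt) (hmap _ hmem2).2
  have hmod' := hmod ξ hmem
  have hc2 : 0 < c^2 := by positivity
  have hd : 0 < f ξ := by
    rcases (hmap _ hmem).1.lt_or_eq with h | h
    · exact h
    · exfalso
      rw [← h] at hmod'
      simp [mu2] at hmod'
      nlinarith
  unfold zvar Delta
  generalize f ξ = d at *
  have hq := q_pos hd hdc
  have hmu := mu2_le hd hdc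
  have hqs : c^2 - d^2 ≤ hsc c t := by linarith
  have hLΛ : Lsc c t ≤ Real.log (c / Real.sqrt (c^2 - d^2)) := by
    have : Real.log (c / Real.sqrt (c^2 - d^2)) = Real.log (c^2 / (c^2 - d^2)) / 2 := by
      rw [Real.log_div hc.ne' (Real.sqrt_pos.2 hq).ne', Real.log_sqrt hq.le,
        Real.log_div hc2.ne' hq.ne', Real.log_pow]
      push_cast
      ring
    rw [this]
    unfold Lsc
    gcongr
  have hΛ4 := hL.trans hLΛ
  have hb := Bg_le hd hdc (hmu.trans (by nlinarith))
  have hi1 := I1_bounds hd hdc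
  have hi2 := I2_bounds hd hdc (by linarith [Real.log_two_lt_d9])
  have hmm := mu2_upper hd hdc (by linarith)
  refine zbound (s := c^2/3 - ξ) hc hd (Real.sqrt_pos.2 (by linarith)) ?_ hL hLΛ ht0 hq hε1 hlt
    (by linarith) hhp (by linarith) (by nlinarith) ?_ hb.1 hb.2 hi2.1 hi2.2 hi1.1 hi1.2 hF
  · rw [Real.sqrt_le_left hd.le]
    linarith
  · have h1 : (c^2 - d^2) * (Real.log (c / Real.sqrt (c^2 - d^2)) - 3) ≤ 3 * (c^2/3 - ξ) := by
      linarith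
    calc _ ≤ 3 * (c^2/3 - ξ) * t := by gcongr
      _ = 3 * (t * (c^2/3 - ξ)) := by ring
      _ ≤ 3 * ((1-ε) * Real.log t / (24*c)) := by linarith
      _ = _ := by field_simp; ring
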